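/- arXiv:2512.10292 — 2 statements merged into one kernel-verified Lean document; each statement's English description precedes it below -/
import Mathlib

section
/- Let G be an n-player polynomial game over a compact basic semialgebraic set X ⊆ ℝ^m whose quadratic module Q(X) is Archimedean, and for each player i let H_i(x) = ∇²_{x_i}u_i(x) denote the Hessian of u_i with respect to player i's variables and B_i = {y ∈ ℝ^{m_i} : yᵀy = 1}. Then G is strictly concave (i.e., H_i(x) is negative definite for every x ∈ X and every i) if and only if there exist a finite level ℓ ∈ ℕ and λ < 0 such that for every player i, the polynomial (x,y) ↦ λ − yᵀ H_i(x) y belongs to Q_ℓ(X × B_i). -/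
open MvPolynomial Finset

noncomputable section

/-- `p` is a sum of squares of polynomials. -/
def IsSOS {σ : Type*} (p : MvPolynomial σ ℝ) : Prop :=
  ∃ (k : ℕ) (q : Fin k → MvPolynomial σ ℝ), p = ∑ i, q i ^ 2

/-- Membership in the quadratic module generated by the inequality polynomials `g`
and the equality polynomials `h`. -/
def InQM {σ ιg ιh : Type*} [Fintype ιg] [Fintype ιh]
    (g : ιg → MvPolynomial σ ℝ) (h : ιh → MvPolynomial σ ℝ)
    (p : MvPolynomial σ ℝ) : Prop :=
  ∃ (s0 : MvPolynomial σ ℝ) (s : ιg → MvPolynomial σ ℝ) (q : ιh → MvPolynomial σ ℝ),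
    IsSOS s0 ∧ (∀ j, IsSOS (s j)) ∧
      p = s0 + ∑ j, g j * s j + ∑ j, h j * q j

/-- Membership in the degree-`ℓ` truncation of the quadratic module: all the SOS
multipliers and the polynomial multipliers have degree at most `ℓ`. -/
def InQMdeg {σ ιg ιh : Type*} [Fintype ιg] [Fintype ιh]
    (ℓ : ℕ) (g : ιg → MvPolynomial σ ℝ) (h : ιh → MvPolynomial σ ℝ)
    (p : MvPolynomial σ ℝ) : Prop :=
  ∃ (s0 : MvPolynomial σ ℝ) (s : ιg → MvPolynomial σ ℝ) (q : ιh → MvPolynomial σ ℝ),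
    IsSOS s0 ∧ (∀ j, IsSOS (s j)) ∧
      s0.totalDegree ≤ ℓ ∧ (∀ j, (s j).totalDegree ≤ ℓ) ∧ (∀ j, (q j).totalDegree ≤ ℓ) ∧
      p = s0 + ∑ j, g j * s j + ∑ j, h j * q j

/-- The basic semialgebraic set `{x | g j x ≥ 0 for all j, h j x = 0 for all j}`. -/
def semialgSet {m : ℕ} {ιg ιh : Type*} (g : ιg → MvPolynomial (Fin m) ℝ)
    (h : ιh → MvPolynomial (Fin m) ℝ) : Set (Fin m → ℝ) :=
  {x | (∀ j, 0 ≤ eval x (g j)) ∧ ∀ j, eval x (h j) = 0}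
/-- Entry `(j, k)` of the Hessian `H_i(x) = ∇²_{x_i} u_i(x)` of player `i`'s payoff with
respect to player `i`'s own variables (the variables `a` with `π a = i`). -/
def hessEntry {m n : ℕ} (π : Fin m → Fin n) (u : Fin n → MvPolynomial (Fin m) ℝ)
    (i : Fin n) (j k : {a : Fin m // π a = i}) : MvPolynomial (Fin m) ℝ :=
  pderiv j.1 (pderiv k.1 (u i))

/-- The quadratic form `yᵀ H_i(x) y` of player `i`'s Hessian, for `y ∈ ℝ^{m_i}`. -/
def hessForm {m n : ℕ} (π : Fin m → Fin n) (u : Fin n → MvPolynomial (Fin m) ℝ)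
    (i : Fin n) (x : Fin m → ℝ) (y : {a : Fin m // π a = i} → ℝ) : ℝ :=
  ∑ j, ∑ k, y j * y k * eval x (hessEntry π u i j k)
/-- The inequality polynomials of `X`, viewed as polynomials in the variables `(x, y)`. -/
def liftIneq {m : ℕ} {ιg : Type*} (τ : Type*) (g : ιg → MvPolynomial (Fin m) ℝ) :
    ιg → MvPolynomial (Fin m ⊕ τ) ℝ :=
  fun j => rename Sum.inl (g j)

/-- The equality polynomials of `X` together with `1 - yᵀy`, viewed as polynomials in the
variables `(x, y)`; together with `liftIneq` these define `X × B`. -/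
def liftEq {m : ℕ} {ιh : Type*} (τ : Type*) [Fintype τ] (h : ιh → MvPolynomial (Fin m) ℝ) :
    ιh ⊕ Unit → MvPolynomial (Fin m ⊕ τ) ℝ :=
  Sum.elim (fun j => rename Sum.inl (h j)) (fun _ => 1 - ∑ t : τ, X (Sum.inr t) ^ 2)
/-- The polynomial `yᵀ H_i(x) y` in the variables `(x, y)`, where `y` ranges over player
`i`'s variables. -/
def hessFormPoly {m n : ℕ} (π : Fin m → Fin n) (u : Fin n → MvPolynomial (Fin m) ℝ)
    (i : Fin n) : MvPolynomial (Fin m ⊕ {a : Fin m // π a = i}) ℝ :=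
  ∑ j : {a : Fin m // π a = i}, ∑ k : {a : Fin m // π a = i},
    X (Sum.inr j) * X (Sum.inr k) * rename Sum.inl (hessEntry π u i j k)

/-- A quadratic module of a commutative ring. -/
structure IsQuadraticModule {A : Type*} [CommRing A] (M : Set A) : Prop where
  one_mem : 1 ∈ M
  add_mem : ∀ {a b : A}, a ∈ M → b ∈ M → a + b ∈ M
  sq_mul_mem : ∀ (a : A) {b : A}, b ∈ M → a ^ 2 * b ∈ M

/-- The normalized linear functionals on `A` that are nonnegative on `M`. -/
def states {A : Type*} [CommRing A] [Algebra ℝ A] (M : Set A) : Set (A → ℝ) :=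
  {L | (∀ a b, L (a + b) = L a + L b) ∧ (∀ (c : ℝ) a, L (c • a) = c * L a) ∧ L 1 = 1 ∧
    ∀ a ∈ M, 0 ≤ L a}

section QuadraticModule

variable {A : Type*} [CommRing A] {M : Set A}

lemma IsQuadraticModule.sq_mem (hM : IsQuadraticModule M) (a : A) : a ^ 2 ∈ M := by
  simpa using hM.sq_mul_mem a hM.one_mem

lemma IsQuadraticModule.zero_mem (hM : IsQuadraticModule M) : (0 : A) ∈ M := by
  simpa using hM.sq_mem 0

lemma IsQuadraticModule.sum_mem (hM : IsQuadraticModule M) {ι : Type*} (s : Finset ι) {f : ι → A}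
    (hf : ∀ i ∈ s, f i ∈ M) : ∑ i ∈ s, f i ∈ M :=
  Finset.sum_induction f (· ∈ M) (fun _ _ => hM.add_mem) hM.zero_mem hf

variable [Algebra ℝ A]

lemma IsQuadraticModule.smul_mem (hM : IsQuadraticModule M) {c : ℝ} (hc : 0 ≤ c) {a : A}
    (ha : a ∈ M) : c • a ∈ M := by
  have := hM.sq_mul_mem (algebraMap ℝ A √c) ha
  rwa [← map_pow, Real.sq_sqrt hc, ← Algebra.smul_def] at this

/-- If `-1` lies in a quadratic module then the module is everything. -/
lemma IsQuadraticModule.mem_of_neg_one_mem (hM : IsQuadraticModule M) (h : (-1 : A) ∈ M) (f : A) :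
    f ∈ M := by
  have h1 := hM.smul_mem (c := 1 / 4) (by norm_num)
    (hM.add_mem (hM.sq_mem (f + 1)) (hM.sq_mul_mem (f - 1) h))
  have h2 : (1 / 4 : ℝ) • ((f + 1) ^ 2 + (f - 1) ^ 2 * (-1)) = f := by
    have : (f + 1) ^ 2 + (f - 1) ^ 2 * (-1) = (4 : ℝ) • f := by
      rw [ofNat_smul_eq_nsmul ℝ 4 f]; simp; ring
    rw [this, smul_smul]; norm_num
  rwa [h2] at h1

lemma IsQuadraticModule.mul_bounded (hM : IsQuadraticModule M) {a b : A} {c d : ℝ}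
    (hc : 0 ≤ c) (ha : algebraMap ℝ A c - a ^ 2 ∈ M) (hb : algebraMap ℝ A d - b ^ 2 ∈ M) :
    algebraMap ℝ A (c * d) - (a * b) ^ 2 ∈ M := by
  have := hM.add_mem (hM.sq_mul_mem b ha) (hM.smul_mem hc hb)
  convert this using 1
  rw [Algebra.smul_def, map_mul]; ring

lemma IsQuadraticModule.add_bounded (hM : IsQuadraticModule M) {a b : A} {c d : ℝ}
    (ha : algebraMap ℝ A c - a ^ 2 ∈ M) (hb : algebraMap ℝ A d - b ^ 2 ∈ M) :
    algebraMap ℝ A (2 * (c + d)) - (a + b) ^ 2 ∈ M := by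
  have h1 := hM.add_mem ha hb
  have := hM.add_mem (hM.add_mem h1 h1) (hM.sq_mem (a - b))
  convert this using 1
  simp only [map_mul, map_add, map_ofNat]; ring

lemma IsQuadraticModule.exists_sub_mem (hM : IsQuadraticModule M) {a : A} {c : ℝ}
    (ha : algebraMap ℝ A c - a ^ 2 ∈ M) : ∃ d : ℝ, algebraMap ℝ A d - a ∈ M := by
  refine ⟨(c + 1) / 2, ?_⟩
  have := hM.smul_mem (c := 1 / 2) (by norm_num) (hM.add_mem ha (hM.sq_mem (1 - a)))
  convert this using 1
  have h : algebraMap ℝ A c - a ^ 2 + (1 - a) ^ 2 = (2 : ℝ) • (algebraMap ℝ A ((c + 1) / 2) - a) := by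
    rw [ofNat_smul_eq_nsmul ℝ 2, smul_sub, nsmul_eq_mul, nsmul_eq_mul]
    have : ((2 : ℕ) : A) = algebraMap ℝ A 2 := (map_natCast (algebraMap ℝ A) 2).symm
    rw [this, ← map_mul, show (2 : ℝ) * ((c + 1) / 2) = c + 1 by ring, map_add, map_one, map_ofNat]
    ring
  rw [h, smul_smul]; norm_num

/-- An element outside an Archimedean quadratic module is nonpositive at some state. -/
lemma exists_state_nonpos (hM : IsQuadraticModule M)
    (harch : ∀ a : A, ∃ d : ℝ, algebraMap ℝ A d - a ∈ M) {f : A} (hf : f ∉ M) :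
    ∃ L ∈ states M, L f ≤ 0 := by
  let S : PointedCone ℝ A :=
    { carrier := {a | ∃ m ∈ M, ∃ c : ℝ, 0 ≤ c ∧ a = m - c • f}
      zero_mem' := ⟨0, hM.zero_mem, 0, le_rfl, by simp⟩
      smul_mem' := by
        rintro ⟨r, hr⟩ _ ⟨m, hm, c, hc, rfl⟩
        refine ⟨r • m, hM.smul_mem hr hm, r * c, mul_nonneg hr hc, ?_⟩
        rw [← smul_smul, ← smul_sub]
        rfl
      add_mem' := by
        rintro _ _ ⟨m, hm, c, hc, rfl⟩ ⟨m', hm', c', hc', rfl⟩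
        exact ⟨m + m', hM.add_mem hm hm', c + c', by positivity, by rw [add_smul]; abel⟩ }
  have hMS : ∀ m ∈ M, m ∈ S := fun m hm => ⟨m, hm, 0, le_rfl, by simp⟩
  have hneg : (-1 : A) ∉ S := by
    rintro ⟨m, hm, c, hc, h⟩
    rcases hc.eq_or_lt with rfl | hc
    · rw [zero_smul, sub_zero] at h
      exact hf (hM.mem_of_neg_one_mem (h ▸ hm) f)
    · have h1 : c • f = m + 1 := by rw [← neg_neg (1 : A), h]; abel
      have h2 := hM.smul_mem (inv_nonneg.2 hc.le) (hM.add_mem hm hM.one_mem)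
      rw [← h1, smul_smul, inv_mul_cancel₀ hc.ne', one_smul] at h2
      exact hf h2
  have h10 : (1 : A) ≠ 0 := by
    intro h
    exact hf ((by rw [← mul_one f, h, mul_zero] : f = 0) ▸ hM.zero_mem)
  let φ : A →ₗ.[ℝ] ℝ := LinearPMap.mkSpanSingleton 1 1 h10
  have hφ : ∀ (c : ℝ) (hc : c • (1 : A) ∈ φ.domain), φ ⟨c • (1 : A), hc⟩ = c := by
    intro c hc
    exact (LinearPMap.mkSpanSingleton'_apply (1 : A) (1 : ℝ) _ c hc).trans (mul_one c)
  obtain ⟨L, hL, hLS⟩ := riesz_extension S φ (by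
    rintro ⟨x, hx⟩ hxS
    obtain ⟨c, rfl⟩ := Submodule.mem_span_singleton.1 hx
    rw [hφ]
    by_contra! hc
    apply hneg
    have : (-c)⁻¹ • c • (1 : A) ∈ S :=
      S.smul_mem (inv_pos.2 (neg_pos.2 hc)).le hxS
    rw [smul_smul, inv_neg, neg_mul, inv_mul_cancel₀ hc.ne, neg_smul, one_smul] at this
    exact this) (by
    intro y
    obtain ⟨d, hd⟩ := harch (-y)
    refine ⟨⟨d • 1, Submodule.smul_mem _ _ (Submodule.mem_span_singleton_self _)⟩, ?_⟩
    apply hMS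
    simpa [Algebra.algebraMap_eq_smul_one] using hd)
  refine ⟨L, ⟨map_add L, fun c a => by simp, ?_, fun a ha => hLS a (hMS a ha)⟩, ?_⟩
  · have h1 : (1 : ℝ) • (1 : A) ∈ φ.domain :=
      Submodule.smul_mem _ _ (Submodule.mem_span_singleton_self _)
    have h2 := (hL ⟨_, h1⟩).trans (hφ 1 h1)
    simpa using h2
  · have : -f ∈ S := ⟨0, hM.zero_mem, 1, zero_le_one, by simp⟩
    simpa using hLS _ this

lemma isCompact_states (harch : ∀ a : A, ∃ d : ℝ, algebraMap ℝ A d - a ∈ M) :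
    IsCompact (states M) := by
  choose d hd using harch
  have hlin : ∀ L ∈ states M, ∀ a, L a ≤ d a := by
    intro L hL a
    have h1 := hL.2.2.2 _ (hd a)
    have h2 := hL.1 (algebraMap ℝ A (d a) - a) a
    rw [sub_add_cancel, Algebra.algebraMap_eq_smul_one, hL.2.1, hL.2.2.1] at h2
    rw [Algebra.algebraMap_eq_smul_one] at h1
    linarith
  refine (isCompact_univ_pi fun a => isCompact_Icc (a := -d (-a)) (b := d a)).of_isClosed_subset
    ?_ ?_
  · have : states M = (⋂ a, ⋂ b, {L : A → ℝ | L (a + b) = L a + L b}) ∩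
        ((⋂ c : ℝ, ⋂ a, {L : A → ℝ | L (c • a) = c * L a}) ∩ ({L | L 1 = 1} ∩
          ⋂ a ∈ M, {L : A → ℝ | 0 ≤ L a})) := by
      ext L; simp [states]
    rw [this]
    refine .inter (isClosed_iInter fun a => isClosed_iInter fun b => ?_)
      (.inter (isClosed_iInter fun a => isClosed_iInter fun b => ?_)
      (.inter ?_ (isClosed_iInter fun a => isClosed_iInter fun b => ?_)))
    · exact isClosed_eq (by fun_prop) (by fun_prop)
    · exact isClosed_eq (by fun_prop) (by fun_prop)
    · exact isClosed_eq (by fun_prop) (by fun_prop)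
    · exact isClosed_le (by fun_prop) (by fun_prop)
  · intro L hL a _
    refine ⟨?_, hlin L hL a⟩
    have h1 := hlin L hL (-a)
    have h2 := hL.2.1 (-1) a
    rw [neg_one_smul] at h2
    linarith

lemma le_mul_of_sq_le_of_le_pow {a : ℕ → ℝ} {N c : ℝ} (hc : 0 < c) (ha : ∀ k, 0 ≤ a k)
    (hsq : ∀ k, a k ^ 2 ≤ a 0 * a (2 * k)) (hle : ∀ k, a k ≤ N * c ^ k) : a 1 ≤ c * a 0 := by
  by_contra! hlt
  have h0 : 0 < a 0 := by
    refine (ha 0).lt_of_ne fun h => ?_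
    have := hsq 1
    rw [← h] at this hlt
    nlinarith
  set q := a 1 / a 0 with hq
  have hqc : c < q := by rwa [hq, lt_div_iff₀ h0]
  have hq0 : 0 < q := hc.trans hqc
  have hpow : ∀ k, q ^ 2 ^ k * a 0 ≤ a (2 ^ k) := by
    intro k
    induction k with
    | zero => simp [hq, h0.ne']
    | succ k ih =>
      have h1 := hsq (2 ^ k)
      have h2 : (q ^ 2 ^ k * a 0) ^ 2 ≤ a (2 ^ k) ^ 2 := by gcongr
      rw [pow_succ' 2 k]
      have h3 : a 0 * (q ^ (2 * 2 ^ k) * a 0) ≤ a 0 * a (2 * 2 ^ k) := by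
        calc _ = (q ^ 2 ^ k * a 0) ^ 2 := by rw [mul_comm 2, pow_mul]; ring
          _ ≤ _ := h2.trans h1
      exact le_of_mul_le_mul_left h3 h0
  have hr : 1 < q / c := by rwa [one_lt_div hc]
  obtain ⟨n, hn⟩ := pow_unbounded_of_one_lt (N / a 0) hr
  have h1 : (q / c) ^ n ≤ (q / c) ^ 2 ^ n := pow_le_pow_right₀ hr.le n.lt_two_pow_self.le
  have h2 := (hpow n).trans (hle (2 ^ n))
  have h3 : (q / c) ^ 2 ^ n ≤ N / a 0 := by
    rw [div_pow, div_le_div_iff₀ (by positivity) h0]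
    exact h2
  linarith

lemma states_map_sub {L : A → ℝ} (hL : L ∈ states M) (a b : A) : L (a - b) = L a - L b := by
  have := hL.1 (a - b) b
  rw [sub_add_cancel] at this
  linarith

lemma states_map_algebraMap_mul {L : A → ℝ} (hL : L ∈ states M) (c : ℝ) (a : A) :
    L (algebraMap ℝ A c * a) = c * L a := by
  rw [← Algebra.smul_def, hL.2.1]

lemma states_sq_mul_le (hM : IsQuadraticModule M)
    (harch : ∀ a : A, ∃ d : ℝ, algebraMap ℝ A d - a ∈ M) {L : A → ℝ} (hL : L ∈ states M)
    {b g : A} (hb : b ∈ M) {c : ℝ} (hc : 0 < c) (hg : algebraMap ℝ A c - g ^ 2 ∈ M) :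
    L (g ^ 2 * b) ≤ c * L b := by
  obtain ⟨N, hN⟩ := harch b
  have hN0 : 0 ≤ max N 0 := le_max_right _ _
  have hpow : ∀ k, L (g ^ (2 * k)) ≤ c ^ k := by
    intro k
    induction k with
    | zero => simp [hL.2.2.1]
    | succ k ih =>
      have h1 := hL.2.2.2 _ (hM.sq_mul_mem (g ^ k) hg)
      rw [show (g ^ k) ^ 2 * (algebraMap ℝ A c - g ^ 2) =
        algebraMap ℝ A c * g ^ (2 * k) - g ^ (2 * (k + 1)) by ring, states_map_sub hL,
        states_map_algebraMap_mul hL] at h1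
      rw [pow_succ']
      nlinarith
  have key := le_mul_of_sq_le_of_le_pow (a := fun k => L (g ^ (2 * k) * b)) (N := max N 0) hc
    (fun k => by
      rw [mul_comm 2 k, pow_mul]
      exact hL.2.2.2 _ (hM.sq_mul_mem _ hb))
    (fun k => by
      have h1 : ∀ s : ℝ, 0 ≤ L (g ^ (2 * 0) * b) * (s * s) + (-2 * L (g ^ (2 * k) * b)) * s +
          L (g ^ (2 * (2 * k)) * b) := by
        intro s
        have h2 := hL.2.2.2 _ (hM.sq_mul_mem (g ^ (2 * k) - algebraMap ℝ A s) hb)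
        rw [show (g ^ (2 * k) - algebraMap ℝ A s) ^ 2 * b =
          g ^ (2 * (2 * k)) * b - algebraMap ℝ A s * (g ^ (2 * k) * b) -
            (algebraMap ℝ A s * (g ^ (2 * k) * b) - algebraMap ℝ A s * (algebraMap ℝ A s * b)) by
              ring, states_map_sub hL, states_map_sub hL, states_map_sub hL,
              states_map_algebraMap_mul hL, states_map_algebraMap_mul hL,
              states_map_algebraMap_mul hL] at h2
        rw [mul_zero, pow_zero, one_mul]
        linarith
      have h3 := discrim_le_zero h1
      rw [discrim] at h3
      linarith)
    (fun k => by
      have h1 := hL.2.2.2 _ (hM.sq_mul_mem (g ^ k) hN)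
      rw [show (g ^ k) ^ 2 * (algebraMap ℝ A N - b) =
        algebraMap ℝ A N * g ^ (2 * k) - g ^ (2 * k) * b by ring, states_map_sub hL,
        states_map_algebraMap_mul hL] at h1
      have h2 : 0 ≤ L (g ^ (2 * k)) := by
        rw [mul_comm 2 k, pow_mul]
        exact hL.2.2.2 _ (hM.sq_mem _)
      calc L (g ^ (2 * k) * b) ≤ N * L (g ^ (2 * k)) := by linarith
        _ ≤ max N 0 * L (g ^ (2 * k)) := by gcongr; exact le_max_left _ _
        _ ≤ _ := by gcongr; exact hpow k)
  simpa using key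

lemma map_sq_mul_of_mem_extremePoints (hM : IsQuadraticModule M)
    (harch : ∀ a : A, ∃ d : ℝ, algebraMap ℝ A d - a ∈ M) {L : A → ℝ}
    (hL : L ∈ (states M).extremePoints ℝ) (g b : A) : L (g ^ 2 * b) = L (g ^ 2) * L b := by
  have hS := hL.1
  obtain ⟨d, hd⟩ := harch (g ^ 2)
  set c := max d 0 + 1 with hc
  have hc0 : 0 < c := by positivity
  have hg : algebraMap ℝ A c - g ^ 2 ∈ M := by
    have := hM.add_mem hd (hM.smul_mem (c := c - d) (by linarith [le_max_left d 0]) hM.one_mem)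
    rw [← Algebra.algebraMap_eq_smul_one, map_sub] at this
    convert this using 1; ring
  have hle : L (g ^ 2) ≤ c := by
    simpa [hS.2.2.1] using states_sq_mul_le hM harch hS hM.one_mem hc0 hg
  have hge : 0 ≤ L (g ^ 2) := hS.2.2.2 _ (hM.sq_mem g)
  set w := L (g ^ 2) + 1 with hw
  set v := c + 1 - L (g ^ 2) with hv
  have hw0 : 0 < w := by linarith
  have hv0 : 0 < v := by linarith
  have h1 : (fun x => w⁻¹ * (L (g ^ 2 * x) + L x)) ∈ states M := by
    refine ⟨fun a b => ?_, fun r a => ?_, ?_, fun a ha => ?_⟩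
    · simp only [mul_add, hS.1]; ring
    · simp only [mul_smul_comm, hS.2.1]; ring
    · simpa only [mul_one, hS.2.2.1] using inv_mul_cancel₀ hw0.ne'
    · have := hS.2.2.2 _ ha
      have := hS.2.2.2 _ (hM.sq_mul_mem g ha)
      positivity
  have h2 : (fun x => v⁻¹ * ((c + 1) * L x - L (g ^ 2 * x))) ∈ states M := by
    refine ⟨fun a b => ?_, fun r a => ?_, ?_, fun a ha => ?_⟩
    · simp only [mul_add, hS.1]; ring
    · simp only [mul_smul_comm, hS.2.1]; ring
    · simpa only [mul_one, hS.2.2.1] using inv_mul_cancel₀ hv0.ne'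
    · have := hS.2.2.2 _ ha
      have := states_sq_mul_le hM harch hS ha hc0 hg
      have : 0 ≤ (c + 1) * L a - L (g ^ 2 * a) := by linarith
      positivity
  have hwv : w + v = c + 2 := by rw [hw, hv]; ring
  have h3 := hL.2 h1 h2 ⟨w / (c + 2), v / (c + 2), by positivity, by positivity, by
    rw [← add_div, hwv, div_self (by positivity)], by
    funext x
    simp only [Pi.add_apply, Pi.smul_apply, smul_eq_mul]
    field_simp
    ring⟩
  have h4 := congrFun h3 b
  rw [inv_mul_eq_iff_eq_mul₀ hw0.ne'] at h4
  rw [hw] at h4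
  linarith

lemma map_mul_of_mem_extremePoints (hM : IsQuadraticModule M)
    (harch : ∀ a : A, ∃ d : ℝ, algebraMap ℝ A d - a ∈ M) {L : A → ℝ}
    (hL : L ∈ (states M).extremePoints ℝ) (a b : A) : L (a * b) = L a * L b := by
  have hS := hL.1
  have h4 : ∀ x : A, L ((a + 1) ^ 2 * x) - L ((a - 1) ^ 2 * x) = 4 * L (a * x) := by
    intro x
    rw [← states_map_sub hS, ← states_map_algebraMap_mul hS, map_ofNat]
    congr 1; ring
  have h1 := h4 b
  have h2 := h4 1
  rw [mul_one, mul_one, mul_one] at h2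
  rw [map_sq_mul_of_mem_extremePoints hM harch hL, map_sq_mul_of_mem_extremePoints hM harch hL,
    ← sub_mul, h2] at h1
  linarith

/-- The representation theorem for Archimedean quadratic modules. -/
theorem exists_algHom_nonpos (hM : IsQuadraticModule M)
    (harch : ∀ a : A, ∃ d : ℝ, algebraMap ℝ A d - a ∈ M) {f : A} (hf : f ∉ M) :
    ∃ φ : A →ₐ[ℝ] ℝ, (∀ a ∈ M, 0 ≤ φ a) ∧ φ f ≤ 0 := by
  obtain ⟨L₀, hL₀, hL₀f⟩ := exists_state_nonpos hM harch hf
  have hK := isCompact_states harch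
  let ev : StrongDual ℝ (A → ℝ) := -ContinuousLinearMap.proj f
  have hexp : IsExposed ℝ (states M) (ev.toExposed (states M)) := ContinuousLinearMap.toExposed.isExposed
  have hne : (ev.toExposed (states M)).Nonempty := by
    obtain ⟨L, hL, hmax⟩ := hK.exists_isMaxOn ⟨L₀, hL₀⟩ ev.continuous.continuousOn
    exact ⟨L, hL, fun y hy => hmax hy⟩
  obtain ⟨L, hL⟩ := (hexp.isCompact hK).extremePoints_nonempty hne
  have hmin := hL.1.2 L₀ hL₀
  have hLe := hexp.isExtreme.extremePoints_subset_extremePoints hL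
  have hS := hLe.1
  refine ⟨{ toFun := L, map_one' := hS.2.2.1, map_mul' := map_mul_of_mem_extremePoints hM harch hLe,
            map_zero' := by simpa using hS.2.1 0 0, map_add' := hS.1,
            commutes' := fun r => by
              have := states_map_algebraMap_mul hS r 1
              rw [mul_one, hS.2.2.1, mul_one] at this
              exact this }, hS.2.2.2, ?_⟩
  have : L f ≤ L₀ f := by simpa [ev] using hmin
  exact this.trans hL₀f

end QuadraticModule

section Putinar

variable {σ ιg ιh : Type*} [Fintype ιg] [Fintype ιh]

lemma IsSOS.zero : IsSOS (0 : MvPolynomial σ ℝ) := ⟨0, Fin.elim0, by simp⟩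

lemma IsSOS.sq (p : MvPolynomial σ ℝ) : IsSOS (p ^ 2) := ⟨1, fun _ => p, by simp⟩

lemma IsSOS.add {p q : MvPolynomial σ ℝ} : IsSOS p → IsSOS q → IsSOS (p + q) := by
  rintro ⟨k, a, rfl⟩ ⟨l, b, rfl⟩
  exact ⟨k + l, Fin.append a b, by simp [Fin.sum_univ_add]⟩

lemma IsSOS.sq_mul (a : MvPolynomial σ ℝ) {p : MvPolynomial σ ℝ} : IsSOS p → IsSOS (a ^ 2 * p) := by
  rintro ⟨k, b, rfl⟩
  exact ⟨k, fun i => a * b i, by simp [Finset.mul_sum, mul_pow]⟩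

lemma IsSOS.rename {τ : Type*} (f : σ → τ) {p : MvPolynomial σ ℝ} :
    IsSOS p → IsSOS (rename f p) := by
  rintro ⟨k, b, rfl⟩
  exact ⟨k, fun i => MvPolynomial.rename f (b i), by simp⟩

lemma IsSOS.eval_nonneg {p : MvPolynomial σ ℝ} (x : σ → ℝ) : IsSOS p → 0 ≤ eval x p := by
  rintro ⟨k, b, rfl⟩
  simp only [map_sum, map_pow]
  positivity

variable (g : ιg → MvPolynomial σ ℝ) (h : ιh → MvPolynomial σ ℝ)

lemma isQuadraticModule_inQM : IsQuadraticModule {p | InQM g h p} where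
  one_mem := ⟨1, 0, 0, by simpa using IsSOS.sq (1 : MvPolynomial σ ℝ), fun _ => .zero, by simp⟩
  add_mem := by
    rintro _ _ ⟨s₀, s, q, hs₀, hs, rfl⟩ ⟨s₀', s', q', hs₀', hs', rfl⟩
    refine ⟨s₀ + s₀', s + s', q + q', hs₀.add hs₀', fun j => (hs j).add (hs' j), ?_⟩
    simp only [Pi.add_apply, mul_add, Finset.sum_add_distrib]
    ring
  sq_mul_mem := by
    rintro a _ ⟨s₀, s, q, hs₀, hs, rfl⟩
    refine ⟨a ^ 2 * s₀, fun j => a ^ 2 * s j, fun j => a ^ 2 * q j, hs₀.sq_mul a,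
      fun j => (hs j).sq_mul a, ?_⟩
    simp only [mul_add, Finset.mul_sum, mul_left_comm]

variable {g h}

lemma InQM.of_ineq [DecidableEq ιg] (j : ιg) : InQM g h (g j) :=
  ⟨0, Pi.single j 1, 0, .zero, fun i => by
    obtain rfl | hij := eq_or_ne i j
    · simpa using IsSOS.sq (1 : MvPolynomial σ ℝ)
    · simpa [hij] using IsSOS.zero, by simp [Pi.single_apply]⟩

lemma InQM.of_eq_mul [DecidableEq ιh] (j : ιh) (p : MvPolynomial σ ℝ) : InQM g h (h j * p) :=
  ⟨0, 0, Pi.single j p, .zero, fun _ => .zero, by simp [Pi.single_apply]⟩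

/-- The module is Archimedean as soon as it bounds the sum of squares of the variables. -/
lemma exists_algebraMap_sub_mem [Fintype σ] {M : Set (MvPolynomial σ ℝ)} (hM : IsQuadraticModule M)
    {N : ℝ} (hN : C N - ∑ i, X i ^ 2 ∈ M) (a : MvPolynomial σ ℝ) :
    ∃ d : ℝ, algebraMap ℝ (MvPolynomial σ ℝ) d - a ∈ M := by
  classical
  suffices ∃ c : ℝ, 0 ≤ c ∧ algebraMap ℝ (MvPolynomial σ ℝ) c - a ^ 2 ∈ M by
    obtain ⟨c, -, hc⟩ := this
    exact hM.exists_sub_mem hc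
  induction a using MvPolynomial.induction_on with
  | C a =>
    refine ⟨a ^ 2, sq_nonneg a, ?_⟩
    rw [algebraMap_eq, C_pow, sub_self]
    exact hM.zero_mem
  | add p q hp hq =>
    obtain ⟨c, hc, hp⟩ := hp
    obtain ⟨d, hd, hq⟩ := hq
    exact ⟨2 * (c + d), by positivity, hM.add_bounded hp hq⟩
  | mul_X p i hp =>
    obtain ⟨c, hc, hp⟩ := hp
    have h1 := hM.add_mem hN (hM.sum_mem (univ.erase i) fun j _ => hM.sq_mem (X j))
    rw [← Finset.add_sum_erase _ _ (mem_univ i), ← sub_sub, sub_add_cancel] at h1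
    have h2 := hM.add_mem h1 (hM.smul_mem (c := |N| - N) (by linarith [le_abs_self N]) hM.one_mem)
    have h3 : algebraMap ℝ (MvPolynomial σ ℝ) |N| - X i ^ 2 ∈ M := by
      rw [← Algebra.algebraMap_eq_smul_one, map_sub, algebraMap_eq] at h2
      convert h2 using 1
      rw [algebraMap_eq]; ring
    exact ⟨c * |N|, by positivity, hM.mul_bounded hc hp h3⟩

/-- **Putinar's Positivstellensatz.** -/
theorem InQM.of_pos [Fintype σ] {N : ℝ} (hN : InQM g h (C N - ∑ i, X i ^ 2))
    {f : MvPolynomial σ ℝ}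
    (hf : ∀ x : σ → ℝ, (∀ j, 0 ≤ eval x (g j)) → (∀ j, eval x (h j) = 0) → 0 < eval x f) :
    InQM g h f := by
  classical
  by_contra hnot
  have hM := isQuadraticModule_inQM g h
  obtain ⟨φ, hφ, hφf⟩ := exists_algHom_nonpos hM (exists_algebraMap_sub_mem hM hN) hnot
  have hev : ∀ p, φ p = eval (fun i => φ (X i)) p := by
    intro p
    conv_lhs => rw [MvPolynomial.aeval_unique φ]
    rfl
  rw [hev] at hφf
  refine hφf.not_gt (hf _ (fun j => ?_) fun j => ?_)
  · rw [← hev]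
    exact hφ _ (.of_ineq j)
  · rw [← hev]
    have h1 := hφ _ (InQM.of_eq_mul (g := g) (h := h) j 1)
    have h2 := hφ _ (InQM.of_eq_mul (g := g) (h := h) j (-1))
    simp only [map_mul, map_neg, map_one] at h1 h2
    linarith

lemma InQM.eventually_inQMdeg {p : MvPolynomial σ ℝ} (hp : InQM g h p) :
    ∀ᶠ ℓ in Filter.atTop, InQMdeg ℓ g h p := by
  obtain ⟨s₀, s, q, hs₀, hs, rfl⟩ := hp
  filter_upwards [Filter.eventually_ge_atTop s₀.totalDegree,
    Filter.eventually_all.2 fun j => Filter.eventually_ge_atTop (s j).totalDegree,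
    Filter.eventually_all.2 fun j => Filter.eventually_ge_atTop (q j).totalDegree] with ℓ h1 h2 h3
  exact ⟨s₀, s, q, hs₀, hs, h1, h2, h3, rfl⟩

lemma InQMdeg.eval_nonneg {ℓ : ℕ} {p : MvPolynomial σ ℝ} (hp : InQMdeg ℓ g h p) {x : σ → ℝ}
    (hg : ∀ j, 0 ≤ eval x (g j)) (hh : ∀ j, eval x (h j) = 0) : 0 ≤ eval x p := by
  obtain ⟨s₀, s, q, hs₀, hs, -, -, -, rfl⟩ := hp
  simp only [map_add, map_sum, map_mul, hh, zero_mul, Finset.sum_const_zero, add_zero]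
  exact add_nonneg (hs₀.eval_nonneg x)
    (Finset.sum_nonneg fun j _ => mul_nonneg (hg j) ((hs j).eval_nonneg x))

end Putinar

section Lift

variable {m : ℕ} {ιg ιh τ : Type*} {g : ιg → MvPolynomial (Fin m) ℝ}
  {h : ιh → MvPolynomial (Fin m) ℝ}

lemma eval_liftIneq (z : Fin m ⊕ τ → ℝ) (j : ιg) :
    eval z (liftIneq τ g j) = eval (z ∘ Sum.inl) (g j) := by
  simp [liftIneq, eval_rename]

variable [Fintype τ]

lemma eval_liftEq_inl (z : Fin m ⊕ τ → ℝ) (j : ιh) :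
    eval z (liftEq τ h (.inl j)) = eval (z ∘ Sum.inl) (h j) := by
  simp [liftEq, eval_rename]

lemma eval_liftEq_inr (z : Fin m ⊕ τ → ℝ) :
    eval z (liftEq τ h (.inr ())) = 1 - ∑ t, z (.inr t) ^ 2 := by
  simp [liftEq]

lemma InQM.lift_archimedean [Fintype ιg] [Fintype ιh] {N : ℝ}
    (hN : InQM g h (C N - ∑ i, X i ^ 2)) :
    InQM (liftIneq τ g) (liftEq τ h) (C (N + 1) - ∑ i, X i ^ 2) := by
  obtain ⟨s₀, s, q, hs₀, hs, hp⟩ := hN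
  refine ⟨rename Sum.inl s₀, fun j => rename Sum.inl (s j),
    Sum.elim (fun j => rename Sum.inl (q j)) 1, hs₀.rename _, fun j => (hs j).rename _, ?_⟩
  have h1 := congrArg (rename (Sum.inl : Fin m → Fin m ⊕ τ)) hp
  simp only [map_sub, map_add, map_sum, map_mul, map_pow, rename_X, rename_C] at h1
  simp only [Fintype.sum_sum_type, liftIneq, liftEq, Sum.elim_inl, Sum.elim_inr, C_add, C_1,
    Pi.one_apply, mul_one, Finset.univ_unique, Finset.sum_singleton]
  linear_combination h1

lemma isCompact_unit_sphere_sum_sq : IsCompact {y : τ → ℝ | ∑ t, y t ^ 2 = 1} := by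
  refine (isCompact_univ_pi fun _ : τ => isCompact_Icc (a := (-1 : ℝ)) (b := 1)).of_isClosed_subset
    (isClosed_eq (by fun_prop) (by fun_prop)) fun y hy t _ => ?_
  have h1 : y t ^ 2 ≤ ∑ t, y t ^ 2 :=
    Finset.single_le_sum (f := fun t => y t ^ 2) (fun _ _ => sq_nonneg _) (mem_univ t)
  rw [hy] at h1
  exact abs_le.1 (by rwa [sq_le_one_iff_abs_le_one] at h1)

end Lift

section Hessian

variable {m n : ℕ} (π : Fin m → Fin n) (u : Fin n → MvPolynomial (Fin m) ℝ) (i : Fin n)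

lemma eval_hessFormPoly (z : Fin m ⊕ {a : Fin m // π a = i} → ℝ) :
    eval z (hessFormPoly π u i) = hessForm π u i (z ∘ Sum.inl) (z ∘ Sum.inr) := by
  simp [hessFormPoly, hessForm, eval_rename]

lemma hessForm_smul (x : Fin m → ℝ) (c : ℝ) (y : {a : Fin m // π a = i} → ℝ) :
    hessForm π u i x (c • y) = c ^ 2 * hessForm π u i x y := by
  simp only [hessForm, Finset.mul_sum, Pi.smul_apply, smul_eq_mul]
  refine Finset.sum_congr rfl fun j _ => Finset.sum_congr rfl fun k _ => ?_
  ring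

lemma continuous_hessForm :
    Continuous fun p : (Fin m → ℝ) × ({a : Fin m // π a = i} → ℝ) => hessForm π u i p.1 p.2 := by
  unfold hessForm
  refine continuous_finsetSum _ fun j _ => continuous_finsetSum _ fun k _ => ?_
  have := (MvPolynomial.continuous_eval (hessEntry π u i j k)).comp
    (continuous_fst (X := Fin m → ℝ) (Y := {a : Fin m // π a = i} → ℝ))
  exact (by fun_prop : Continuous fun p : (Fin m → ℝ) × ({a : Fin m // π a = i} → ℝ) =>
    p.2 j * p.2 k).mul this

variable {π u i}

/-- A negative definite family of Hessians over a compact set is uniformly negative definite. -/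
lemma exists_hessForm_le {K : Set (Fin m → ℝ)} (hK : IsCompact K)
    (hneg : ∀ x ∈ K, ∀ y : {a : Fin m // π a = i} → ℝ, y ≠ 0 → hessForm π u i x y < 0) :
    ∃ c < 0, ∀ x ∈ K, ∀ y : {a : Fin m // π a = i} → ℝ, ∑ t, y t ^ 2 = 1 →
      hessForm π u i x y ≤ c := by
  have hcpt := hK.prod (isCompact_unit_sphere_sum_sq (τ := {a : Fin m // π a = i}))
  rcases (K ×ˢ {y : {a : Fin m // π a = i} → ℝ | ∑ t, y t ^ 2 = 1}).eq_empty_or_nonempty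
    with hemp | hne
  · refine ⟨-1, by norm_num, fun x hx y hy => ?_⟩
    exact (Set.eq_empty_iff_forall_notMem.1 hemp (x, y) ⟨hx, hy⟩).elim
  · obtain ⟨p, ⟨hp1, hp2⟩, hmax⟩ := hcpt.exists_isMaxOn hne (continuous_hessForm π u i).continuousOn
    refine ⟨_, hneg p.1 hp1 p.2 ?_, fun x hx y hy => hmax (a := (x, y)) ⟨hx, hy⟩⟩
    intro h0
    rw [Set.mem_ofPred_eq, h0] at hp2
    simp at hp2

end Hessian

/-- For a polynomial game over a compact basic semialgebraic set `X` with
Archimedean quadratic module, the game is strictly concave (every player's Hessian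
`H_i(x)` is negative definite for every `x ∈ X`) if and only if there are a finite level
`ℓ` and `λ < 0` such that for every player `i` the polynomial `λ - yᵀ H_i(x) y` belongs to
`Q_ℓ(X × B_i)`. -/
theorem strictly_concave_iff_finite_sos_certificate {m n mg mh : ℕ}
    (π : Fin m → Fin n) (u : Fin n → MvPolynomial (Fin m) ℝ)
    (g : Fin mg → MvPolynomial (Fin m) ℝ) (h : Fin mh → MvPolynomial (Fin m) ℝ)
    (hX : IsCompact (semialgSet g h))
    (hArch : ∃ N : ℕ, InQM g h (C (N : ℝ) - ∑ i, X i ^ 2)) :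
    (∀ x ∈ semialgSet g h, ∀ i : Fin n, ∀ y : {a : Fin m // π a = i} → ℝ, y ≠ 0 →
        hessForm π u i x y < 0) ↔
      ∃ (ℓ : ℕ) (lam : ℝ), lam < 0 ∧ ∀ i : Fin n,
        InQMdeg ℓ (liftIneq {a : Fin m // π a = i} g) (liftEq {a : Fin m // π a = i} h)
          (C lam - hessFormPoly π u i) := by
  constructor
  · intro hneg
    choose c hc0 hc using fun i => exists_hessForm_le hX fun x hx => hneg x hx i
    have hlam : ∀ᶠ lam in nhdsWithin (0 : ℝ) (Set.Iio 0), lam < 0 ∧ ∀ i, c i < lam :=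
      Filter.Eventually.and self_mem_nhdsWithin (Filter.eventually_all.2 fun i =>
        nhdsWithin_le_nhds (lt_mem_nhds (hc0 i)))
    obtain ⟨lam, hlam0, hlam⟩ := hlam.exists
    obtain ⟨N, hN⟩ := hArch
    have hQ : ∀ i, InQM (liftIneq {a : Fin m // π a = i} g) (liftEq {a : Fin m // π a = i} h)
        (C lam - hessFormPoly π u i) := by
      intro i
      refine InQM.of_pos hN.lift_archimedean fun z hzg hzh => ?_
      have hy : ∑ t, (z ∘ Sum.inr) t ^ 2 = 1 := by
        have := hzh (.inr ())
        rw [eval_liftEq_inr, sub_eq_zero] at this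
        exact this.symm
      have := hc i (z ∘ Sum.inl) ⟨fun j => by rw [← eval_liftIneq]; exact hzg j,
        fun j => by rw [← eval_liftEq_inl]; exact hzh (.inl j)⟩ (z ∘ Sum.inr) hy
      rw [map_sub, eval_C, eval_hessFormPoly]
      linarith [hlam i]
    obtain ⟨ℓ, hℓ⟩ := (Filter.eventually_all.2 fun i => (hQ i).eventually_inQMdeg).exists
    exact ⟨ℓ, lam, hlam0, hℓ⟩
  · rintro ⟨ℓ, lam, hlam, hcert⟩ x hx i y hy
    have hs : 0 < ∑ t, y t ^ 2 := by
      obtain ⟨t, ht⟩ := Function.ne_iff.1 hy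
      exact Finset.sum_pos' (fun _ _ => sq_nonneg _) ⟨t, mem_univ t, by
        rw [Pi.zero_apply] at ht; positivity⟩
    set s := ∑ t, y t ^ 2 with hs_def
    have h1 := (hcert i).eval_nonneg (x := Sum.elim x ((√s)⁻¹ • y))
      (fun j => by rw [eval_liftIneq, Sum.elim_comp_inl]; exact hx.1 j)
      (by
        rintro (j | ⟨⟩)
        · rw [eval_liftEq_inl, Sum.elim_comp_inl]; exact hx.2 j
        · rw [eval_liftEq_inr]
          simp only [Sum.elim_inr, Pi.smul_apply, smul_eq_mul, mul_pow, ← Finset.mul_sum, ← hs_def,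
            inv_pow, Real.sq_sqrt hs.le]
          rw [inv_mul_cancel₀ hs.ne', sub_self])
    rw [map_sub, eval_C, eval_hessFormPoly, Sum.elim_comp_inl, Sum.elim_comp_inr, hessForm_smul,
      inv_pow, Real.sq_sqrt hs.le] at h1
    have h2 : s⁻¹ * hessForm π u i x y < 0 := by linarith
    exact (mul_neg_iff.1 h2).elim And.right fun h => absurd h.1 (inv_pos.2 hs).not_gt

end
end

section
/- Fix n ∈ ℕ, d ≥ 2, and a compact basic semialgebraic set X ⊆ ℝ^m. Identifying degree-d n-player polynomial games over X with their coefficient vectors in ℝ^M, the set of games that are concave over X (the Hessian H_i(x) = ∇²_{x_i}u_i(x) is negative semidefinite for every player i and every x ∈ X) but not strictly concave over X (not every H_i(x) is negative definite for all i and all x ∈ X) has Lebesgue measure zero in ℝ^M. -/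
open MvPolynomial Finset

noncomputable section

/-- Index set for the monomials of total degree at most `d` in `m` variables: exponent
tuples `e` with `Σ_j e j ≤ d`. -/
abbrev ExpIdx (m d : ℕ) : Type :=
  {e : Fin m → Fin (d + 1) // (∑ j, ((e j : ℕ))) ≤ d}

/-- The polynomial of total degree at most `d` with coefficient vector `c`; this realizes
the identification of degree-`d` payoffs with coefficient vectors in `ℝ^M`. -/
def payoffOf {m : ℕ} (d : ℕ) (c : ExpIdx m d → ℝ) : MvPolynomial (Fin m) ℝ :=
  ∑ e : ExpIdx m d, C (c e) * ∏ j, X j ^ ((e.1 j : ℕ))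

theorem payoffOf_add {m d : ℕ} (c c' : ExpIdx m d → ℝ) :
    payoffOf d (c + c') = payoffOf d c + payoffOf d c' := by
  simp [payoffOf, add_mul, Finset.sum_add_distrib]

theorem payoffOf_smul {m d : ℕ} (r : ℝ) (c : ExpIdx m d → ℝ) :
    payoffOf d (r • c) = r • payoffOf d c := by
  simp [payoffOf, Finset.smul_sum, MvPolynomial.smul_eq_C_mul, mul_assoc]

/-- For a fixed player, point and direction, the Hessian form is linear in the coefficients. -/
theorem isLinearMap_hessForm {m n : ℕ} (d : ℕ) (π : Fin m → Fin n) (i : Fin n)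
    (x : Fin m → ℝ) (y : {a : Fin m // π a = i} → ℝ) :
    IsLinearMap ℝ fun c : Fin n → ExpIdx m d → ℝ =>
      hessForm π (fun i' => payoffOf d (c i')) i x y where
  map_add c c' := by
    simp [hessForm, hessEntry, payoffOf_add, mul_add, Finset.sum_add_distrib]
  map_smul r c := by
    simp only [hessForm, hessEntry, Pi.smul_apply, payoffOf_smul, Derivation.map_smul,
      smul_eval, smul_eq_mul, Finset.mul_sum]
    exact Finset.sum_congr rfl fun j _ => Finset.sum_congr rfl fun k _ => by ring

/-- The exponent of the monomial `X a ^ 2`. -/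
def sqExp {m d : ℕ} (hd : 2 ≤ d) (a : Fin m) : ExpIdx m d :=
  ⟨fun j => if j = a then ⟨2, by omega⟩ else 0, by
    simp only [apply_ite Fin.val, Fin.val_zero, Finset.sum_ite_eq', Finset.mem_univ, if_true]
    exact hd⟩

open Classical in
/-- The coefficient vector of `∑ a, X a ^ 2`. -/
def sqCoeff {m d : ℕ} (hd : 2 ≤ d) (e : ExpIdx m d) : ℝ :=
  ∑ a, if e = sqExp hd a then 1 else 0

theorem payoffOf_sqCoeff {m d : ℕ} (hd : 2 ≤ d) :
    payoffOf d (sqCoeff hd) = ∑ a : Fin m, (X a : MvPolynomial (Fin m) ℝ) ^ 2 := by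
  classical
  simp only [payoffOf, sqCoeff, map_sum, Finset.sum_mul]
  rw [Finset.sum_comm]
  refine Finset.sum_congr rfl fun a _ => ?_
  rw [Finset.sum_eq_single (sqExp hd a) (fun e _ he => by simp [he]) (by simp),
    Finset.prod_eq_single a (fun j _ hj => by simp [sqExp, hj]) (by simp)]
  simp [sqExp]

theorem hessForm_sqCoeff {m n d : ℕ} (hd : 2 ≤ d) (π : Fin m → Fin n) (i : Fin n)
    (x : Fin m → ℝ) (y : {a : Fin m // π a = i} → ℝ) :
    hessForm π (fun _ => payoffOf d (sqCoeff hd)) i x y = 2 * ∑ j, y j ^ 2 := by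
  classical
  have hentry (j k : {a : Fin m // π a = i}) :
      eval x (hessEntry π (fun _ => payoffOf d (sqCoeff hd)) i j k) =
        if k = j then 2 else 0 := by
    rw [hessEntry, payoffOf_sqCoeff]
    have h2 : pderiv j.1 (2 : MvPolynomial (Fin m) ℝ) = 0 :=
      mod_cast (pderiv (R := ℝ) j.1).map_natCast 2
    by_cases hkj : k = j
    · simp [pderiv_X, Pi.single_apply, hkj, h2]
    · simp [pderiv_X, Pi.single_apply, hkj, h2, Subtype.val_inj]
  simp only [hessForm, hentry, mul_ite, mul_zero, Finset.sum_ite_eq', Finset.mem_univ, if_true,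
    Finset.mul_sum]
  exact Finset.sum_congr rfl fun j _ => by ring

/-- The coefficient vectors of the games that are concave over `S`. -/
def concaveGames {m n : ℕ} (d : ℕ) (π : Fin m → Fin n) (S : Set (Fin m → ℝ)) :
    Set (Fin n → ExpIdx m d → ℝ) :=
  {c | ∀ x ∈ S, ∀ i : Fin n, ∀ y : {a : Fin m // π a = i} → ℝ,
    hessForm π (fun i' => payoffOf d (c i')) i x y ≤ 0}

theorem convex_concaveGames {m n : ℕ} (d : ℕ) (π : Fin m → Fin n) (S : Set (Fin m → ℝ)) :
    Convex ℝ (concaveGames d π S) := by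
  simp only [concaveGames, Set.ofPred_forall]
  exact convex_iInter fun x => convex_iInter fun _ => convex_iInter fun i =>
    convex_iInter fun y => convex_halfSpace_le (isLinearMap_hessForm d π i x y) 0

open Topology in
/-- A game in the interior of the set of concave games is strictly concave. -/
theorem hessForm_neg_of_mem_interior_concaveGames {m n d : ℕ} (hd : 2 ≤ d) {π : Fin m → Fin n}
    {S : Set (Fin m → ℝ)} {c : Fin n → ExpIdx m d → ℝ} (hc : c ∈ interior (concaveGames d π S))
    {x : Fin m → ℝ} (hx : x ∈ S) {i : Fin n} {y : {a : Fin m // π a = i} → ℝ} (hy : y ≠ 0) :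
    hessForm π (fun i' => payoffOf d (c i')) i x y < 0 := by
  have hcont : Continuous fun ε : ℝ => c + ε • fun _ : Fin n => sqCoeff (m := m) hd := by
    fun_prop
  have htend : ∀ᶠ ε in 𝓝 (0 : ℝ),
      (c + ε • fun _ : Fin n => sqCoeff (m := m) hd) ∈ concaveGames d π S :=
    hcont.continuousAt.eventually_mem (by simpa using mem_interior_iff_mem_nhds.1 hc)
  obtain ⟨ε, hmem, hε⟩ := ((htend.filter_mono nhdsWithin_le_nhds).and
    (self_mem_nhdsWithin : Set.Ioi (0 : ℝ) ∈ 𝓝[>] 0)).exists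
  have hlin := isLinearMap_hessForm d π i x y
  have hle := hmem x hx i y
  rw [hlin.map_add, hlin.map_smul, hessForm_sqCoeff, smul_eq_mul] at hle
  obtain ⟨j, hj⟩ := Function.ne_iff.1 hy
  have hpos : 0 < ∑ j, y j ^ 2 :=
    Finset.sum_pos' (fun j _ => sq_nonneg _) ⟨j, Finset.mem_univ j, sq_pos_of_ne_zero hj⟩
  have := mul_pos (Set.mem_Ioi.1 hε) hpos
  linarith

open MeasureTheory in
/-- For `d ≥ 2` and a compact basic semialgebraic set `X`, identifying
degree-`d` `n`-player polynomial games over `X` with their coefficient vectors, the set of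
games that are concave over `X` (every player's Hessian is negative semidefinite on `X`)
but not strictly concave over `X` has Lebesgue measure zero in the coefficient space. -/
theorem concave_not_strictly_concave_measure_zero {m n mg mh : ℕ} (d : ℕ) (hd : 2 ≤ d)
    (π : Fin m → Fin n)
    (g : Fin mg → MvPolynomial (Fin m) ℝ) (h : Fin mh → MvPolynomial (Fin m) ℝ)
    (hX : IsCompact (semialgSet g h)) :
    volume {c : Fin n → ExpIdx m d → ℝ |
      (∀ x ∈ semialgSet g h, ∀ i : Fin n, ∀ y : {a : Fin m // π a = i} → ℝ,
          hessForm π (fun i' => payoffOf d (c i')) i x y ≤ 0) ∧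
      ¬ (∀ x ∈ semialgSet g h, ∀ i : Fin n, ∀ y : {a : Fin m // π a = i} → ℝ, y ≠ 0 →
          hessForm π (fun i' => payoffOf d (c i')) i x y < 0)} = 0 := by
  refine measure_mono_null ?_ (Convex.addHaar_frontier volume
    (convex_concaveGames d π (semialgSet g h)))
  rintro c ⟨hc, hstrict⟩
  exact ⟨subset_closure hc, fun hint => hstrict fun _ hx _ _ hy =>
    hessForm_neg_of_mem_interior_concaveGames hd hint hx hy⟩

end
end
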